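/- arXiv:0712.1275 — 2 statements merged into one kernel-verified Lean document; each statement's English description precedes it below -/
import Mathlib

section
/- Almost surely, every interval of local extremum of ω is a single point (i.e. has t_1 = t_2), and all points of local extremum and the ray of local extremum (if it exists) are strict; that is, the set of ω ∈ Ω for which this fails is null. -/
open Filter Topology MeasureTheory
open scoped ENNReal NNReal

namespace GTP

/-- The sample space `Ω`: all continuous functions `ω : [0,∞) → ℝ`. -/
def Omega : Type := {f : ℝ≥0 → ℝ // Continuous f}

/-- The filtration: `F t` is the smallest σ-algebra on `Ω` making all maps
`ω ↦ ω s`, `s ∈ [0,t]`, measurable. -/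
def F (t : ℝ≥0) : MeasurableSpace Omega :=
  ⨆ s : {s : ℝ≥0 // s ≤ t},
    MeasurableSpace.comap (fun ω : Omega => ω.1 s.1) inferInstance

/-- A stopping time relative to the filtration `(F t)`, with values in `[0,∞]`. -/
def IsStopping (τ : Omega → ℝ≥0∞) : Prop :=
  ∀ t : ℝ≥0, MeasurableSet[F t] {ω : Omega | τ ω ≤ (t : ℝ≥0∞)}

/-- `F_τ`-measurability of a function `h : Ω → ℝ`. -/
def MeasurableAtTime (τ : Omega → ℝ≥0∞) (h : Omega → ℝ) : Prop :=
  ∀ B : Set ℝ, MeasurableSet B → ∀ t : ℝ≥0,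
    MeasurableSet[F t] (h ⁻¹' B ∩ {ω : Omega | τ ω ≤ (t : ℝ≥0∞)})

/-- An elementary trading strategy: an increasing sequence of stopping times
`τ₁ ≤ τ₂ ≤ ⋯` tending to `∞`, together with bounded `F_{τ_n}`-measurable
portfolio functions `h_n`. -/
structure ElemStrategy where
  τ : ℕ → Omega → ℝ≥0∞
  stopping : ∀ n, IsStopping (τ n)
  mono : ∀ n ω, τ n ω ≤ τ (n + 1) ω
  tendsto_top : ∀ ω, Tendsto (fun n => τ n ω) atTop (𝓝 ⊤)
  h : ℕ → Omega → ℝ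
  h_bdd : ∀ n, ∃ C : ℝ, ∀ ω, |h n ω| ≤ C
  h_meas : ∀ n, MeasurableAtTime (τ n) (h n)

/-- The time `τ ∧ t` as an element of `[0,∞)`. -/
noncomputable def clip (τ : Omega → ℝ≥0∞) (t : ℝ≥0) (ω : Omega) : ℝ≥0 :=
  (min (τ ω) (t : ℝ≥0∞)).toNNReal

/-- The elementary capital process
`K_t(ω) := c + Σ_n h_n(ω) (ω(τ_{n+1} ∧ t) − ω(τ_n ∧ t))`. -/
noncomputable def elemCapital (G : ElemStrategy) (c : ℝ) (t : ℝ≥0) (ω : Omega) : ℝ :=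
  c + ∑' n : ℕ, G.h n ω * (ω.1 (clip (G.τ (n + 1)) t ω) - ω.1 (clip (G.τ n) t ω))

/-- A positive capital process: a countable sum of nonnegative elementary capital
processes with strictly positive summable initial capitals. -/
structure PosCapital where
  G : ℕ → ElemStrategy
  c : ℕ → ℝ
  c_pos : ∀ n, 0 < c n
  c_summable : Summable c
  nonneg : ∀ n t ω, 0 ≤ elemCapital (G n) (c n) t ω

/-- The value `S_t(ω) ∈ [0,∞]` of a positive capital process. -/
noncomputable def PosCapital.value (S : PosCapital) (t : ℝ≥0) (ω : Omega) : ℝ≥0∞ :=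
  ∑' n : ℕ, ENNReal.ofReal (elemCapital (S.G n) (S.c n) t ω)

/-- The initial value `S_0` of a positive capital process (independent of `ω`,
since `K^{G_n,c_n}_0 = c_n`). -/
noncomputable def PosCapital.init (S : PosCapital) : ℝ≥0∞ :=
  ∑' n : ℕ, ENNReal.ofReal (S.c n)

/-- Upper probability:
`UpProb(E) := inf { S₀ : S a positive capital process, liminf_{t→∞} S_t ≥ 1_E }`. -/
noncomputable def UpProb (E : Set Omega) : ℝ≥0∞ :=
  ⨅ (S : PosCapital) (_ : ∀ ω : Omega,
      E.indicator (fun _ => (1 : ℝ≥0∞)) ω ≤ liminf (fun t : ℝ≥0 => S.value t ω) atTop),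
    S.init

/-- A set is null if its upper probability is `0`. -/
def IsNull (E : Set Omega) : Prop := UpProb E = 0

/-- `[t₁,t₂]` is an interval of local extremum for `ω`, where the comparison
relation `r` is `≤` for a local maximum, `≥` for a local minimum, `<` for a
strict local maximum and `>` for a strict local minimum: (a) `ω` is constant on
`[t₁,t₂]` but on no larger interval, and (b) for some `δ > 0`,
`r (ω s) (ω t)` for all `s ∈ ((t₁−δ)⁺,t₁) ∪ (t₂,t₂+δ)` and `t ∈ [t₁,t₂]`. -/
def IntervalOfLocalExt (r : ℝ → ℝ → Prop) (ω : Omega) (t₁ t₂ : ℝ≥0) : Prop :=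
  t₁ ≤ t₂ ∧
  (∀ t ∈ Set.Icc t₁ t₂, ω.1 t = ω.1 t₁) ∧
  (¬ ∃ s₁ s₂ : ℝ≥0, s₁ ≤ t₁ ∧ t₂ ≤ s₂ ∧ (s₁ < t₁ ∨ t₂ < s₂) ∧
      ∀ t ∈ Set.Icc s₁ s₂, ω.1 t = ω.1 t₁) ∧
  ∃ δ : ℝ, 0 < δ ∧ ∀ s : ℝ≥0,
    (((t₁ : ℝ) - δ < (s : ℝ) ∧ s < t₁) ∨ (t₂ < s ∧ (s : ℝ) < (t₂ : ℝ) + δ)) →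
      r (ω.1 s) (ω.1 t₁)

/-- `[t,∞)` is a ray of local extremum for `ω` (with `r` as above): (a) `ω` is
constant on `[t,∞)` but on no larger ray `[s,∞)`, `s ∈ (0,t)`, and (b) for some
`δ > 0`, `r (ω s) (ω t)` for all `s ∈ ((t−δ)⁺, t)`. -/
def RayOfLocalExt (r : ℝ → ℝ → Prop) (ω : Omega) (t : ℝ≥0) : Prop :=
  (∀ u : ℝ≥0, t ≤ u → ω.1 u = ω.1 t) ∧
  (¬ ∃ s : ℝ≥0, 0 < s ∧ s < t ∧ ∀ u : ℝ≥0, s ≤ u → ω.1 u = ω.1 t) ∧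
  ∃ δ : ℝ, 0 < δ ∧ ∀ s : ℝ≥0, (t : ℝ) - δ < (s : ℝ) → s < t → r (ω.1 s) (ω.1 t)

/-- Running maximum of `σ * ω` over `[p,a]`. -/
noncomputable def Ms (σ : ℝ) (p a : ℝ≥0) (ω : Omega) : ℝ :=
  sSup ((fun s => σ * ω.1 s) '' Set.Icc p a)

theorem cont_sig (σ : ℝ) (ω : Omega) : Continuous (fun s => σ * ω.1 s) :=
  continuous_const.mul ω.2

theorem Ms_bdd (σ : ℝ) (p a : ℝ≥0) (ω : Omega) :
    BddAbove ((fun s => σ * ω.1 s) '' Set.Icc p a) :=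
  (isCompact_Icc.image (cont_sig σ ω)).bddAbove

theorem le_Ms (σ : ℝ) {p a s : ℝ≥0} (ω : Omega) (h1 : p ≤ s) (h2 : s ≤ a) :
    σ * ω.1 s ≤ Ms σ p a ω :=
  le_csSup (Ms_bdd σ p a ω) ⟨s, ⟨h1, h2⟩, rfl⟩

theorem Ms_attained (σ : ℝ) {p a : ℝ≥0} (ω : Omega) (h : p ≤ a) :
    ∃ s, p ≤ s ∧ s ≤ a ∧ σ * ω.1 s = Ms σ p a ω := by
  have := (isCompact_Icc.image (cont_sig σ ω)).sSup_mem
    ((Set.nonempty_Icc.2 h).image (fun s => σ * ω.1 s))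
  obtain ⟨s, hs, h⟩ := this
  exact ⟨s, hs.1, hs.2, h⟩

theorem Ms_meas (σ : ℝ) {p a t : ℝ≥0} (hpa : p ≤ a) (hat : a ≤ t) :
    Measurable[F t] (Ms σ p a) := by
  haveI : Nonempty (Set.Icc p a) := ⟨⟨p, le_refl _, hpa⟩⟩
  have key : Ms σ p a = fun ω => ⨆ n : ℕ,
      σ * ω.1 (TopologicalSpace.denseSeq (Set.Icc p a) n : ℝ≥0) := by
    funext ω
    apply le_antisymm
    · obtain ⟨s, h1, h2, h3⟩ := Ms_attained σ ω hpa
      rw [← h3]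
      have hbd : BddAbove (Set.range fun n : ℕ =>
          σ * ω.1 (TopologicalSpace.denseSeq (Set.Icc p a) n : ℝ≥0)) := by
        refine (Ms_bdd σ p a ω).mono ?_
        rintro _ ⟨n, rfl⟩
        exact ⟨_, (TopologicalSpace.denseSeq (Set.Icc p a) n).2, rfl⟩
      have hcl : IsClosed {x : Set.Icc p a | σ * ω.1 x.1 ≤ ⨆ n : ℕ,
          σ * ω.1 (TopologicalSpace.denseSeq (Set.Icc p a) n : ℝ≥0)} :=
        isClosed_le ((cont_sig σ ω).comp continuous_subtype_val) continuous_const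
      have hsub : closure (Set.range (TopologicalSpace.denseSeq (Set.Icc p a))) ⊆
          {x : Set.Icc p a | σ * ω.1 x.1 ≤ ⨆ n : ℕ,
          σ * ω.1 (TopologicalSpace.denseSeq (Set.Icc p a) n : ℝ≥0)} := by
        apply hcl.closure_subset_iff.2
        rintro _ ⟨n, rfl⟩
        exact le_ciSup hbd n
      have := TopologicalSpace.denseRange_denseSeq (Set.Icc p a)
      exact hsub (this ⟨s, h1, h2⟩)
    · apply ciSup_le
      intro n
      exact le_Ms σ ω (TopologicalSpace.denseSeq (Set.Icc p a) n).2.1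
        (TopologicalSpace.denseSeq (Set.Icc p a) n).2.2
  rw [key]
  letI : MeasurableSpace Omega := F t
  refine Measurable.iSup (fun n => ?_)
  refine Measurable.const_mul ?_ σ
  have hs := (TopologicalSpace.denseSeq (Set.Icc p a) n).2.2.trans hat
  have h1 : MeasurableSpace.comap (fun ω : Omega =>
      ω.1 (TopologicalSpace.denseSeq (Set.Icc p a) n : ℝ≥0)) inferInstance ≤ F t :=
    le_iSup (fun s : {s : ℝ≥0 // s ≤ t} =>
      MeasurableSpace.comap (fun ω : Omega => ω.1 s.1) inferInstance) ⟨_, hs⟩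
  exact measurable_iff_comap_le.2 h1

/-- First time in `[a,b]` at which `σ * ω` reaches `L`, and `b` if there is none. -/
noncomputable def hit (σ : ℝ) (a b : ℝ≥0) (L : Omega → ℝ) (ω : Omega) : ℝ≥0 :=
  sInf {s | s = b ∨ (a ≤ s ∧ s ≤ b ∧ L ω ≤ σ * ω.1 s)}

theorem hit_mem (σ : ℝ) (a b : ℝ≥0) (L : Omega → ℝ) (ω : Omega) :
    hit σ a b L ω = b ∨
      (a ≤ hit σ a b L ω ∧ hit σ a b L ω ≤ b ∧ L ω ≤ σ * ω.1 (hit σ a b L ω)) := by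
  have hcl : IsClosed {s | s = b ∨ (a ≤ s ∧ s ≤ b ∧ L ω ≤ σ * ω.1 s)} := by
    apply IsClosed.union isClosed_singleton
    exact (isClosed_le continuous_const continuous_id).inter
      ((isClosed_le continuous_id continuous_const).inter
        (isClosed_le continuous_const (cont_sig σ ω)))
  exact hcl.csInf_mem ⟨b, Or.inl rfl⟩ (OrderBot.bddBelow _)

theorem hit_le_b (σ : ℝ) (a b : ℝ≥0) (L : Omega → ℝ) (ω : Omega) : hit σ a b L ω ≤ b :=
  csInf_le (OrderBot.bddBelow _) (Or.inl rfl)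

theorem hit_le (σ : ℝ) {a b : ℝ≥0} (L : Omega → ℝ) (ω : Omega) {s : ℝ≥0}
    (h1 : a ≤ s) (h2 : s ≤ b) (h3 : L ω ≤ σ * ω.1 s) : hit σ a b L ω ≤ s :=
  csInf_le (OrderBot.bddBelow _) (Or.inr ⟨h1, h2, h3⟩)

theorem le_hit (σ : ℝ) {a b : ℝ≥0} (hab : a ≤ b) (L : Omega → ℝ) (ω : Omega) :
    a ≤ hit σ a b L ω := by
  rcases hit_mem σ a b L ω with h | h
  · rw [h]; exact hab
  · exact h.1

theorem hit_stopping (σ : ℝ) {a b : ℝ≥0} (hab : a ≤ b) (L : Omega → ℝ)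
    (hL : ∀ t, a ≤ t → Measurable[F t] L) :
    IsStopping (fun ω => (hit σ a b L ω : ℝ≥0∞)) := by
  intro t
  simp only [ENNReal.coe_le_coe]
  by_cases hbt : b ≤ t
  · convert MeasurableSet.univ (m := F t) (α := Omega)
    simp only [Set.mem_univ, iff_true, Set.mem_ofPred_eq, Set.ext_iff]
    intro ω
    exact (hit_le_b σ a b L ω).trans hbt
  push Not at hbt
  by_cases hat : a ≤ t
  · have : {ω : Omega | hit σ a b L ω ≤ t} = {ω | L ω ≤ Ms σ a t ω} := by
      ext ω
      simp only [Set.mem_ofPred_eq]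
      constructor
      · intro h
        rcases hit_mem σ a b L ω with h' | h'
        · rw [h'] at h; exact absurd h (not_le.2 hbt)
        · exact h'.2.2.trans (le_Ms σ ω h'.1 h)
      · intro h
        obtain ⟨s, h1, h2, h3⟩ := Ms_attained σ ω hat
        exact (hit_le σ L ω h1 (h2.trans hbt.le) (h3 ▸ h)).trans h2
    rw [this]
    exact @measurableSet_le _ _ _ _ _ (F t) _ _ _ _ _ (hL t hat) (Ms_meas σ hat le_rfl)
  · convert @MeasurableSet.empty Omega (F t)
    simp only [Set.mem_empty_iff_false, iff_false, Set.mem_ofPred_eq, Set.ext_iff]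
    intro ω h
    exact hat ((le_hit σ hab L ω).trans h)

/-- `E` can be covered with arbitrarily small initial capital by one elementary process. -/
def ElemNull (E : Set Omega) : Prop :=
  ∀ ε : ℝ, 0 < ε → ∃ (G : ElemStrategy) (c : ℝ), 0 < c ∧ c ≤ ε ∧
    (∀ t ω, 0 ≤ elemCapital G c t ω) ∧
    ∀ ω ∈ E, ∃ T, ∀ t, T ≤ t → 1 ≤ elemCapital G c t ω

theorem isNull_iUnion (E : ℕ → Set Omega) (hE : ∀ n, ElemNull (E n)) (A : Set Omega)
    (hA : A ⊆ ⋃ n, E n) : IsNull A := by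
  unfold IsNull
  apply le_antisymm _ (zero_le)
  apply ENNReal.le_of_forall_pos_le_add
  intro ε hε _
  rw [zero_add]
  have hε' : (0 : ℝ) < ε := hε
  choose G c hc0 hcε hnn hge using fun n => hE n (ε / 2 / 2 ^ n) (by positivity)
  have hsum := hasSum_geometric_two' (ε : ℝ)
  have hsc : Summable c := Summable.of_nonneg_of_le (fun n => (hc0 n).le) hcε hsum.summable
  let S : PosCapital := ⟨G, c, hc0, hsc, hnn⟩
  have hS : ∀ ω : Omega,
      A.indicator (fun _ => (1 : ℝ≥0∞)) ω ≤ liminf (fun t : ℝ≥0 => S.value t ω) atTop := by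
    intro ω
    by_cases hω : ω ∈ A
    · rw [Set.indicator_of_mem hω]
      obtain ⟨n, hn⟩ := Set.mem_iUnion.1 (hA hω)
      obtain ⟨T, hT⟩ := hge n ω hn
      apply le_liminf_of_le
      · isBoundedDefault
      filter_upwards [eventually_ge_atTop T] with t ht
      refine le_trans ?_ (ENNReal.le_tsum n)
      rw [← ENNReal.ofReal_one]
      exact ENNReal.ofReal_le_ofReal (hT t ht)
    · rw [Set.indicator_of_notMem hω]
      exact zero_le
  refine (iInf₂_le S hS).trans ?_
  show ∑' n : ℕ, ENNReal.ofReal (c n) ≤ ε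
  rw [← ENNReal.ofReal_tsum_of_nonneg (fun n => (hc0 n).le) hsc, ← ENNReal.ofReal_coe_nnreal]
  apply ENNReal.ofReal_le_ofReal
  rw [← hsum.tsum_eq]
  exact hsc.tsum_le_tsum hcε hsum.summable

/-- The trading strategy: hold `h` units between two stopping times. -/
noncomputable def holdStrategy (τ₁ τ₂ : Omega → ℝ≥0) (h₁ : IsStopping (fun ω => (τ₁ ω : ℝ≥0∞)))
    (h₂ : IsStopping (fun ω => (τ₂ ω : ℝ≥0∞))) (hle : ∀ ω, τ₁ ω ≤ τ₂ ω) (h : ℝ) :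
    ElemStrategy where
  τ n ω := match n with
    | 0 => τ₁ ω
    | 1 => τ₂ ω
    | _ + 2 => ⊤
  stopping n := by
    match n with
    | 0 => exact h₁
    | 1 => exact h₂
    | n + 2 =>
      intro t
      simp
  mono n ω := by
    match n with
    | 0 => exact ENNReal.coe_le_coe.2 (hle ω)
    | 1 => exact le_top
    | n + 2 => exact le_top
  tendsto_top ω := by
    apply tendsto_const_nhds.congr'
    filter_upwards [eventually_ge_atTop 2] with n hn
    obtain ⟨k, rfl⟩ := Nat.exists_eq_add_of_le' hn
    rfl
  h n _ := if n = 0 then h else 0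
  h_bdd n := ⟨_, fun _ => le_rfl⟩
  h_meas n := by
    intro B _ t
    apply MeasurableSet.inter
    · exact (@measurable_const _ _ _ (F t) _) ‹_›
    · match n with
      | 0 => exact h₁ t
      | 1 => exact h₂ t
      | n + 2 => simp

theorem holdCapital (τ₁ τ₂ : Omega → ℝ≥0) (h₁ : IsStopping (fun ω => (τ₁ ω : ℝ≥0∞)))
    (h₂ : IsStopping (fun ω => (τ₂ ω : ℝ≥0∞))) (hle : ∀ ω, τ₁ ω ≤ τ₂ ω) (h c : ℝ) (t : ℝ≥0)
    (ω : Omega) : elemCapital (holdStrategy τ₁ τ₂ h₁ h₂ hle h) c t ω =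
      c + h * (ω.1 (min (τ₂ ω) t) - ω.1 (min (τ₁ ω) t)) := by
  unfold elemCapital
  rw [tsum_eq_single 0]
  · have e : ∀ x : ℝ≥0, (min (x : ℝ≥0∞) (t : ℝ≥0∞)).toNNReal = min x t := by
      intro x
      rw [← ENNReal.coe_min, ENNReal.toNNReal_coe]
    simp [holdStrategy, clip, e]
  · intro n hn
    simp [holdStrategy, hn]

/-- The basic null events. -/
def Ev (σ : ℝ) (p a b : ℝ≥0) (D : ℝ) : Set Omega :=
  {ω | Ms σ a b ω = Ms σ p a ω ∧ σ * ω.1 b ≤ Ms σ p a ω - D}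

theorem Ev_null (σ : ℝ) {p a b : ℝ≥0} (hpa : p ≤ a) (hab : a ≤ b) {D : ℝ} (hD : 0 < D) :
    ElemNull (Ev σ p a b D) := by
  intro ε hε
  have hL1 : ∀ t, a ≤ t → Measurable[F t] (Ms σ p a) := fun t ht => Ms_meas σ hpa ht
  have hL2 : ∀ t, a ≤ t → Measurable[F t] (fun ω => Ms σ p a ω + ε * D) := fun t ht =>
    Measurable.add_const (m := F t) (Ms_meas σ hpa ht) _
  have hεD : 0 < ε * D := by positivity
  set τ₁ := hit σ a b (Ms σ p a) with hτ₁
  set τ₂ := hit σ a b (fun ω => Ms σ p a ω + ε * D) with hτ₂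
  have hle : ∀ ω, τ₁ ω ≤ τ₂ ω := by
    intro ω
    rcases hit_mem σ a b (fun ω => Ms σ p a ω + ε * D) ω with h | h
    · rw [hτ₂, h]; exact hit_le_b _ _ _ _ _
    · exact hit_le σ _ ω h.1 h.2.1 (by linarith [h.2.2])
  -- before `τ₁` the process stays below the level
  have hbelow : ∀ (L : Omega → ℝ) ω, σ * ω.1 a ≤ L ω → ∀ s, a ≤ s → s ≤ hit σ a b L ω →
      σ * ω.1 s ≤ L ω := by
    intro L ω h0 s h1 h2
    by_contra hcon
    push Not at hcon
    -- intermediate value theorem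
    have hsub := intermediate_value_Icc h1 (cont_sig σ ω).continuousOn
    obtain ⟨u, hu, hu'⟩ := hsub ⟨h0, hcon.le⟩
    have hu'' : σ * ω.1 u = L ω := hu'
    have hus : u < s := lt_of_le_of_ne hu.2 (by rintro rfl; linarith)
    have := hit_le σ L ω hu.1 (hus.le.trans (h2.trans (hit_le_b _ _ _ _ _))) hu''.ge
    exact absurd (lt_of_lt_of_le hus h2) (not_lt.2 this)
  have haM : ∀ ω : Omega, σ * ω.1 a ≤ Ms σ p a ω := fun ω => le_Ms σ ω hpa le_rfl
  refine ⟨holdStrategy τ₁ τ₂ (hit_stopping σ hab _ hL1) (hit_stopping σ hab _ hL2) hle (-σ / D),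
    ε, hε, le_rfl, ?_, ?_⟩
  · intro t ω
    rw [holdCapital]
    rcases le_total t (τ₁ ω) with h | h
    · rw [min_eq_right h, min_eq_right (h.trans (hle ω))]
      simp [hε.le]
    · rw [min_eq_left h]
      rcases hit_mem σ a b (Ms σ p a) ω with h' | h'
      · have : τ₂ ω = τ₁ ω := le_antisymm ((hit_le_b _ _ _ _ _).trans h'.ge) (hle ω)
        rw [this, min_eq_left h]
        simp [hε.le]
      · have h3 : σ * ω.1 (min (τ₂ ω) t) ≤ Ms σ p a ω + ε * D := by
          refine hbelow (fun ω => Ms σ p a ω + ε * D) ω (by linarith [haM ω]) _ ?_ (min_le_left _ _)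
          exact le_min (h'.1.trans (hle ω)) (h'.1.trans h)
        have h4 : Ms σ p a ω ≤ σ * ω.1 (τ₁ ω) := h'.2.2
        have : ε + -σ / D * (ω.1 (min (τ₂ ω) t) - ω.1 (τ₁ ω)) =
          (ε * D - (σ * ω.1 (min (τ₂ ω) t) - σ * ω.1 (τ₁ ω))) / D := by
          field_simp
          ring
        rw [this]
        apply div_nonneg _ hD.le
        linarith
  · rintro ω ⟨h1, h2⟩
    refine ⟨b, fun t ht => ?_⟩
    rw [holdCapital]
    obtain ⟨s, hs1, hs2, hs3⟩ := Ms_attained σ ω hab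
    have h4 : Ms σ p a ω ≤ σ * ω.1 (τ₁ ω) := by
      rcases hit_mem σ a b (Ms σ p a) ω with h' | h'
      · have := hit_le σ (Ms σ p a) ω hs1 hs2 (by rw [hs3, h1])
        rw [h'] at this
        have : s = b := le_antisymm hs2 this
        rw [hτ₁, h', ← this, hs3, h1]
      · exact h'.2.2
    have h5 : τ₂ ω = b := by
      rcases hit_mem σ a b (fun ω => Ms σ p a ω + ε * D) ω with h' | h'
      · exact h'
      · have := le_Ms σ ω h'.1 h'.2.1
        have := h'.2.2
        linarith
    rw [h5, min_eq_left ht, min_eq_left ((hit_le_b _ _ _ _ _).trans ht)]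
    have : ε + -σ / D * (ω.1 b - ω.1 (τ₁ ω)) =
          ε + (σ * ω.1 (τ₁ ω) - σ * ω.1 b) / D := by
      field_simp
      ring
    have h6 : 1 ≤ (σ * ω.1 (τ₁ ω) - σ * ω.1 b) / D := by
      rw [le_div_iff₀ hD]
      linarith
    rw [this]
    linarith

/-- Deterministic badness. -/
def Bad (f : ℝ≥0 → ℝ) : Prop :=
  ∃ (p s₁ s₂ c : ℝ≥0) (M : ℝ), p < s₁ ∧ s₁ < s₂ ∧ f s₁ = M ∧ f s₂ = M ∧
    (∀ s, p < s → s < c → f s ≤ M) ∧ ∃ b, s₂ < b ∧ b < c ∧ f b < M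

/-- The countable family of null events. -/
noncomputable def EvI (i : ℕ × ℕ × ℕ × ℕ × Bool) : Set Omega :=
  Ev (if i.2.2.2.2 then 1 else -1) (TopologicalSpace.denseSeq ℝ≥0 i.1)
    (max (TopologicalSpace.denseSeq ℝ≥0 i.1) (TopologicalSpace.denseSeq ℝ≥0 i.2.1))
    (max (max (TopologicalSpace.denseSeq ℝ≥0 i.1) (TopologicalSpace.denseSeq ℝ≥0 i.2.1))
      (TopologicalSpace.denseSeq ℝ≥0 i.2.2.1)) (1 / ((i.2.2.2.1 : ℝ) + 1))

theorem EvI_null (i) : ElemNull (EvI i) :=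
  Ev_null _ (le_max_left _ _) (le_max_left _ _) (by positivity)

theorem bad_mem (σ : Bool) (ω : Omega) (h : Bad (fun s => (if σ then (1 : ℝ) else -1) * ω.1 s)) :
    ∃ i, ω ∈ EvI i := by
  obtain ⟨p, s₁, s₂, c, M, hp, hs, hf1, hf2, hM, b, hb1, hb2, hb3⟩ := h
  have dense := TopologicalSpace.denseRange_denseSeq ℝ≥0
  obtain ⟨_, ⟨i, rfl⟩, hi1, hi2⟩ := dense.exists_between hp
  obtain ⟨_, ⟨j, rfl⟩, hj1, hj2⟩ := dense.exists_between hs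
  have hop : IsOpen (Set.Ioo s₂ c ∩ {s | (if σ then (1 : ℝ) else -1) * ω.1 s < M}) :=
    isOpen_Ioo.inter (isOpen_lt (cont_sig _ ω) continuous_const)
  obtain ⟨k, ⟨hk1, hk2⟩, hk3⟩ := dense.exists_mem_open hop ⟨b, ⟨hb1, hb2⟩, hb3⟩
  replace hk3 : (if σ then (1 : ℝ) else -1) * ω.1 (TopologicalSpace.denseSeq ℝ≥0 k) < M := hk3
  have hk3' := sub_pos.2 hk3
  obtain ⟨m, hm⟩ := exists_nat_one_div_lt hk3'
  refine ⟨(i, j, k, m, σ), ?_⟩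
  unfold EvI Ev
  simp only
  generalize (if σ then (1 : ℝ) else -1) = σ' at *
  generalize TopologicalSpace.denseSeq ℝ≥0 i = p' at *
  generalize TopologicalSpace.denseSeq ℝ≥0 j = a' at *
  generalize TopologicalSpace.denseSeq ℝ≥0 k = b' at *
  have hpa : p' ≤ a' := (hi2.trans hj1).le
  have hab : a' ≤ b' := (hj2.trans hk1).le
  rw [max_eq_right hpa, max_eq_right hab]
  have e1 : Ms σ' p' a' ω = M := by
    apply le_antisymm
    · obtain ⟨s, h1, h2, h3⟩ := Ms_attained σ' ω hpa
      rw [← h3]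
      exact hM s (hi1.trans_le h1) (h2.trans_lt (hab.trans_lt hk2))
    · rw [← hf1]; exact le_Ms σ' ω hi2.le hj1.le
  have e2 : Ms σ' a' b' ω = M := by
    apply le_antisymm
    · obtain ⟨s, h1, h2, h3⟩ := Ms_attained σ' ω hab
      rw [← h3]
      exact hM s (hi1.trans_le (hpa.trans h1)) (h2.trans_lt hk2)
    · rw [← hf2]; exact le_Ms σ' ω hj2.le hk1.le
  refine ⟨e2.trans e1.symm, ?_⟩
  rw [e1]
  linarith

theorem bad_left (f : ℝ≥0 → ℝ) (t : ℝ≥0) (δ : ℝ) (hδ : 0 < δ)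
    (h1 : ∀ s : ℝ≥0, (t : ℝ) - δ < s → s < t → f s ≤ f t)
    (h2 : ∀ δ' : ℝ, 0 < δ' → ∃ s : ℝ≥0, (t : ℝ) - δ' < s ∧ s < t ∧ f t ≤ f s)
    (h3 : ∀ s : ℝ≥0, 0 < s → s < t → ∃ u, s < u ∧ u < t ∧ f u ≠ f t) : Bad f := by
  obtain ⟨p, hp1, hp2, -⟩ := h2 δ hδ
  have hp2' : (p : ℝ) < t := hp2
  have h2' : ∀ q : ℝ≥0, q < t → ∃ s, q < s ∧ s < t ∧ f t ≤ f s := by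
    intro q hq
    have hq' : (q : ℝ) < t := hq
    obtain ⟨s, a, b, c⟩ := h2 (t - q) (by linarith)
    refine ⟨s, ?_, b, c⟩
    have : (q : ℝ) < s := by linarith
    exact this
  have h1' : ∀ s, p < s → s < t → f s ≤ f t := by
    intro s hs hs'
    have : (p : ℝ) < s := hs
    exact h1 s (by linarith) hs'
  obtain ⟨s₁, a1, a2, a3⟩ := h2' p hp2
  obtain ⟨s₂, b1, b2, b3⟩ := h2' s₁ a2
  obtain ⟨b, c1, c2, c3⟩ := h3 s₂ (lt_of_le_of_lt (zero_le) b1) b2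
  refine ⟨p, s₁, s₂, t, f t, a1, b1, le_antisymm (h1' _ a1 a2) a3,
    le_antisymm (h1' _ (a1.trans b1) b2) b3, h1', b, c1, c2, ?_⟩
  exact lt_of_le_of_ne (h1' _ (a1.trans (b1.trans c1)) c2) c3

theorem bad_right (f : ℝ≥0 → ℝ) (t : ℝ≥0) (δ : ℝ) (hδ : 0 < δ)
    (h1 : ∀ s : ℝ≥0, t < s → (s : ℝ) < t + δ → f s ≤ f t)
    (h2 : ∀ δ' : ℝ, 0 < δ' → ∃ s : ℝ≥0, t < s ∧ (s : ℝ) < t + δ' ∧ f t ≤ f s)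
    (h3 : ∀ s : ℝ≥0, t < s → ∃ u, t < u ∧ u ≤ s ∧ f u ≠ f t) : Bad f := by
  obtain ⟨c, hc1, hc2, -⟩ := h2 δ hδ
  have h2' : ∀ q : ℝ≥0, t < q → ∃ s, t < s ∧ s < q ∧ f t ≤ f s := by
    intro q hq
    have hq' : (t : ℝ) < q := hq
    obtain ⟨s, a, b, c⟩ := h2 (q - t) (by linarith)
    refine ⟨s, a, ?_, c⟩
    have : (s : ℝ) < q := by linarith
    exact this
  have h1' : ∀ s, t < s → s < c → f s ≤ f t := by
    intro s hs hs'
    have : (s : ℝ) < c := hs'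
    exact h1 s hs (by linarith)
  obtain ⟨c', hc'1, hc'2⟩ := exists_between hc1
  obtain ⟨b, d1, d2, d3⟩ := h3 c' hc'1
  obtain ⟨s₂, a1, a2, a3⟩ := h2' b d1
  obtain ⟨s₁, b1, b2, b3⟩ := h2' s₂ a1
  have hbc := d2.trans_lt hc'2
  refine ⟨t, s₁, s₂, c, f t, b1, b2, le_antisymm (h1' _ b1 (b2.trans (a2.trans hbc))) b3,
    le_antisymm (h1' _ a1 (a2.trans hbc)) a3, h1', b, a2, hbc, ?_⟩
  exact lt_of_le_of_ne (h1' _ d1 hbc) d3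

theorem bad_interval (ω : Omega) (t₁ t₂ : ℝ≥0) (hne : t₁ ≠ t₂)
    (h : IntervalOfLocalExt (· ≤ ·) ω t₁ t₂) : Bad ω.1 := by
  obtain ⟨hle, hc, hn, δ, hδ, hd⟩ := h
  have hlt := lt_of_le_of_ne hle hne
  obtain ⟨s₁, a1, a2⟩ := exists_between hlt
  obtain ⟨s₂, b1, b2⟩ := exists_between a2
  have hδ' : 0 < δ.toNNReal := Real.toNNReal_pos.2 hδ
  obtain ⟨c', c1, c2⟩ := exists_between (lt_add_of_pos_right t₂ hδ')
  have hM : ∀ s, t₁ < s → s < t₂ + δ.toNNReal → ω.1 s ≤ ω.1 t₁ := by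
    intro s h1 h2
    rcases le_or_gt s t₂ with h | h
    · exact (hc s ⟨h1.le, h⟩).le
    · refine hd s (Or.inr ⟨h, ?_⟩)
      have : (s : ℝ) < ((t₂ + δ.toNNReal : ℝ≥0) : ℝ) := h2
      rwa [NNReal.coe_add, Real.coe_toNNReal _ hδ.le] at this
  have : ∃ b, t₁ ≤ b ∧ b ≤ c' ∧ ω.1 b ≠ ω.1 t₁ := by
    by_contra hcon
    push Not at hcon
    exact hn ⟨t₁, c', le_rfl, c1.le, Or.inr c1, fun t ht => hcon t ht.1 ht.2⟩
  obtain ⟨b, d1, d2, d3⟩ := this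
  have hb : t₂ < b := by
    by_contra hcon
    exact d3 (hc b ⟨d1, not_lt.1 hcon⟩)
  exact ⟨t₁, s₁, s₂, t₂ + δ.toNNReal, ω.1 t₁, a1, b1, hc _ ⟨a1.le, a2.le⟩,
    hc _ ⟨(a1.trans b1).le, b2.le⟩, hM, b, b2.trans hb, d2.trans_lt c2,
    lt_of_le_of_ne (hM b (hlt.trans hb) (d2.trans_lt c2)) d3⟩

theorem bad_point (ω : Omega) (t : ℝ≥0)
    (h : IntervalOfLocalExt (· ≤ ·) ω t t) (h' : ¬ IntervalOfLocalExt (· < ·) ω t t) :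
    Bad ω.1 := by
  obtain ⟨hle, hc, hn, δ, hδ, hd⟩ := h
  by_cases hl : ∀ δ' : ℝ, 0 < δ' → ∃ s : ℝ≥0, (t : ℝ) - δ' < s ∧ s < t ∧ ω.1 t ≤ ω.1 s
  · refine bad_left ω.1 t δ hδ (fun s h1 h2 => hd s (Or.inl ⟨h1, h2⟩)) hl ?_
    intro s hs0 hs
    by_contra hcon
    push Not at hcon
    obtain ⟨s', h1, h2⟩ := exists_between hs
    refine hn ⟨s', t, h2.le, le_rfl, Or.inl h2, fun u hu => ?_⟩
    rcases hu.2.eq_or_lt with e | e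
    · rw [e]
    · exact hcon u (h1.trans_le hu.1) e
  by_cases hr : ∀ δ' : ℝ, 0 < δ' → ∃ s : ℝ≥0, t < s ∧ (s : ℝ) < t + δ' ∧ ω.1 t ≤ ω.1 s
  · refine bad_right ω.1 t δ hδ (fun s h1 h2 => hd s (Or.inr ⟨h1, h2⟩)) hr ?_
    intro s hs
    by_contra hcon
    push Not at hcon
    refine hn ⟨t, s, le_rfl, hs.le, Or.inr hs, fun u hu => ?_⟩
    rcases hu.1.eq_or_lt with e | e
    · rw [e]
    · exact hcon u e hu.2
  exfalso
  push Not at hl hr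
  obtain ⟨δ₁, hδ₁, hl⟩ := hl
  obtain ⟨δ₂, hδ₂, hr⟩ := hr
  refine h' ⟨hle, hc, hn, min δ₁ δ₂, lt_min hδ₁ hδ₂, fun s hs => ?_⟩
  rcases hs with ⟨h1, h2⟩ | ⟨h1, h2⟩
  · exact hl s (by linarith [min_le_left δ₁ δ₂]) h2
  · exact hr s h1 (by linarith [min_le_right δ₁ δ₂])

theorem bad_ray (ω : Omega) (t : ℝ≥0)
    (h : RayOfLocalExt (· ≤ ·) ω t) (h' : ¬ RayOfLocalExt (· < ·) ω t) : Bad ω.1 := by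
  obtain ⟨hc, hn, δ, hδ, hd⟩ := h
  refine bad_left ω.1 t δ hδ hd ?_ ?_
  · by_contra hcon
    push Not at hcon
    obtain ⟨δ', h1, h2⟩ := hcon
    exact h' ⟨hc, hn, δ', h1, h2⟩
  · intro s hs0 hs
    by_contra hcon
    push Not at hcon
    obtain ⟨s', h1, h2⟩ := exists_between hs
    refine hn ⟨s', hs0.trans h1, h2, fun u hu => ?_⟩
    rcases lt_or_ge u t with e | e
    · exact hcon u (h1.trans_le hu) e
    · exact hc u e

/-- The reflected path. -/
def negO (ω : Omega) : Omega := ⟨fun s => - ω.1 s, ω.2.neg⟩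

theorem interval_ge (ω : Omega) (t₁ t₂ : ℝ≥0) :
    IntervalOfLocalExt (· ≥ ·) ω t₁ t₂ ↔ IntervalOfLocalExt (· ≤ ·) (negO ω) t₁ t₂ := by
  simp [IntervalOfLocalExt, negO]

theorem interval_gt (ω : Omega) (t₁ t₂ : ℝ≥0) :
    IntervalOfLocalExt (· > ·) ω t₁ t₂ ↔ IntervalOfLocalExt (· < ·) (negO ω) t₁ t₂ := by
  simp [IntervalOfLocalExt, negO]

theorem ray_ge (ω : Omega) (t : ℝ≥0) :
    RayOfLocalExt (· ≥ ·) ω t ↔ RayOfLocalExt (· ≤ ·) (negO ω) t := by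
  simp [RayOfLocalExt, negO]

theorem ray_gt (ω : Omega) (t : ℝ≥0) :
    RayOfLocalExt (· > ·) ω t ↔ RayOfLocalExt (· < ·) (negO ω) t := by
  simp [RayOfLocalExt, negO]

/-- almost surely, every interval of local extremum is a single
point, and all points of local extremum and the ray of local extremum (if any)
are strict. -/
theorem local_extrema_are_points_and_strict :
    IsNull {ω : Omega |
      (∃ t₁ t₂ : ℝ≥0, t₁ ≠ t₂ ∧
        (IntervalOfLocalExt (· ≤ ·) ω t₁ t₂ ∨ IntervalOfLocalExt (· ≥ ·) ω t₁ t₂)) ∨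
      (∃ t : ℝ≥0,
        (IntervalOfLocalExt (· ≤ ·) ω t t ∧ ¬ IntervalOfLocalExt (· < ·) ω t t) ∨
        (IntervalOfLocalExt (· ≥ ·) ω t t ∧ ¬ IntervalOfLocalExt (· > ·) ω t t)) ∨
      (∃ t : ℝ≥0,
        (RayOfLocalExt (· ≤ ·) ω t ∧ ¬ RayOfLocalExt (· < ·) ω t) ∨
        (RayOfLocalExt (· ≥ ·) ω t ∧ ¬ RayOfLocalExt (· > ·) ω t))} := by
  obtain ⟨e, he⟩ := exists_surjective_nat (ℕ × ℕ × ℕ × ℕ × Bool)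
  refine isNull_iUnion (fun n => EvI (e n)) (fun n => EvI_null _) _ ?_
  intro ω hω
  have key : Bad ω.1 ∨ Bad (negO ω).1 := by
    rcases hω with ⟨t₁, t₂, hne, h | h⟩ | ⟨t, ⟨h, h'⟩ | ⟨h, h'⟩⟩ | ⟨t, ⟨h, h'⟩ | ⟨h, h'⟩⟩
    · exact Or.inl (bad_interval ω _ _ hne h)
    · exact Or.inr (bad_interval _ _ _ hne ((interval_ge _ _ _).1 h))
    · exact Or.inl (bad_point ω _ h h')
    · exact Or.inr (bad_point _ _ ((interval_ge _ _ _).1 h) (fun h2 => h' ((interval_gt _ _ _).2 h2)))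
    · exact Or.inl (bad_ray ω _ h h')
    · exact Or.inr (bad_ray _ _ ((ray_ge _ _).1 h) (fun h2 => h' ((ray_gt _ _).2 h2)))
  have : ∃ i, ω ∈ EvI i := by
    rcases key with h | h
    · exact bad_mem true ω (by simpa using h)
    · exact bad_mem false ω (by simpa [negO] using h)
  obtain ⟨i, hi⟩ := this
  obtain ⟨n, rfl⟩ := he i
  exact Set.mem_iUnion.2 ⟨n, hi⟩

end GTP
end

section
/- Almost surely, every neighbourhood of every point of non-constancy of ω contains a point of local maximum of ω and a point of local minimum of ω; that is, the set of ω ∈ Ω for which this fails is null. -/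
open Filter Topology MeasureTheory
open scoped ENNReal NNReal

namespace GTP

/-- `t` is a point of constancy for `ω`: `ω` is constant on some neighbourhood
`((t−δ)⁺, t+δ)` of `t`. -/
def PointOfConstancy (ω : Omega) (t : ℝ≥0) : Prop :=
  ∃ δ : ℝ, 0 < δ ∧ ∀ s : ℝ≥0,
    (t : ℝ) - δ < (s : ℝ) → (s : ℝ) < (t : ℝ) + δ → ω.1 s = ω.1 t

/-- `t` is a point of local maximum for `ω`: `ω` is constant on no open
neighbourhood of `t`, and `ω(s) ≤ ω(t)` on some neighbourhood of `t`. -/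
def PointOfLocalMax (ω : Omega) (t : ℝ≥0) : Prop :=
  ¬ PointOfConstancy ω t ∧
  ∃ δ : ℝ, 0 < δ ∧ ∀ s : ℝ≥0,
    (t : ℝ) - δ < (s : ℝ) → (s : ℝ) < (t : ℝ) + δ → ω.1 s ≤ ω.1 t

/-- `t` is a point of local minimum for `ω`. -/
def PointOfLocalMin (ω : Omega) (t : ℝ≥0) : Prop :=
  ¬ PointOfConstancy ω t ∧
  ∃ δ : ℝ, 0 < δ ∧ ∀ s : ℝ≥0,
    (t : ℝ) - δ < (s : ℝ) → (s : ℝ) < (t : ℝ) + δ → ω.1 t ≤ ω.1 s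

lemma meas_eval {s t : ℝ≥0} (h : s ≤ t) : Measurable[F t] (fun ω : Omega => ω.1 s) := by
  have h1 : MeasurableSpace.comap (fun ω : Omega => ω.1 s) inferInstance ≤ F t :=
    le_iSup (fun s : {s : ℝ≥0 // s ≤ t} =>
      MeasurableSpace.comap (fun ω : Omega => ω.1 s.1) inferInstance) ⟨s, h⟩
  exact (comap_measurable (fun ω : Omega => ω.1 s)).mono h1 le_rfl

/-- The set of times after `p` at which the bet is to be stopped. -/
def stopSet (p r : ℝ≥0) (l c : ℝ) (ω : Omega) : Set ℝ≥0 :=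
  {s | p ≤ s ∧ (l * (ω.1 s - ω.1 p) ≤ -c ∨ p + r ≤ s)}

/-- The time at which the bet is stopped. -/
noncomputable def stopT (p r : ℝ≥0) (l c : ℝ) (ω : Omega) : ℝ≥0 :=
  sInf (stopSet p r l c ω)

lemma gain_cont (p : ℝ≥0) (l : ℝ) (ω : Omega) :
    Continuous (fun s => l * (ω.1 s - ω.1 p)) :=
  continuous_const.mul (ω.2.sub continuous_const)

lemma stopSet_closed (p r : ℝ≥0) (l c : ℝ) (ω : Omega) : IsClosed (stopSet p r l c ω) := by
  have hg := gain_cont p l ω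
  have h1 : IsClosed {s : ℝ≥0 | p ≤ s} := isClosed_Ici
  have h2 : IsClosed {s : ℝ≥0 | p + r ≤ s} := isClosed_Ici
  exact h1.inter ((isClosed_le hg continuous_const).union h2)

lemma stopT_mem (p r : ℝ≥0) (l c : ℝ) (ω : Omega) :
    stopT p r l c ω ∈ stopSet p r l c ω :=
  (stopSet_closed p r l c ω).csInf_mem ⟨p + r, by simp [stopSet]⟩ (OrderBot.bddBelow _)

lemma stopT_le {p r : ℝ≥0} {l c : ℝ} {ω : Omega} {s : ℝ≥0} (h : s ∈ stopSet p r l c ω) :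
    stopT p r l c ω ≤ s := csInf_le (OrderBot.bddBelow _) h

lemma stopT_le_iff {p r : ℝ≥0} {l c : ℝ} {ω : Omega} {t : ℝ≥0} :
    stopT p r l c ω ≤ t ↔ ∃ s ≤ t, s ∈ stopSet p r l c ω :=
  ⟨fun h => ⟨_, h, stopT_mem p r l c ω⟩, fun ⟨_, h1, h2⟩ => (stopT_le h2).trans h1⟩

lemma gain_ge {p r : ℝ≥0} {l c : ℝ} (hc : 0 < c) {ω : Omega} {s : ℝ≥0} (hp : p ≤ s)
    (hs : s ≤ stopT p r l c ω) : -c ≤ l * (ω.1 s - ω.1 p) := by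
  by_contra! hlt
  obtain ⟨u, hu, hgu⟩ := intermediate_value_Icc' hp (gain_cont p l ω).continuousOn
    (show -c ∈ Set.Icc (l * (ω.1 s - ω.1 p)) (l * (ω.1 p - ω.1 p)) from
      ⟨hlt.le, by simp [hc.le]⟩)
  have hmem : u ∈ stopSet p r l c ω := ⟨hu.1, Or.inl hgu.le⟩
  have : u = s := le_antisymm hu.2 (hs.trans (stopT_le hmem))
  subst this
  simp only at hgu
  linarith

lemma stopT_stopping (p r : ℝ≥0) (l c : ℝ) :
    IsStopping (fun ω => (stopT p r l c ω : ℝ≥0∞)) := by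
  intro t
  simp only [ENNReal.coe_le_coe]
  by_cases hpt : p ≤ t
  swap
  · convert MeasurableSet.empty
    ext ω
    simp only [Set.mem_ofPred_eq, Set.mem_empty_iff_false, iff_false]
    exact fun h => hpt ((stopT_mem p r l c ω).1.trans h)
  by_cases hqt : p + r ≤ t
  · convert MeasurableSet.univ
    ext ω
    simp only [Set.mem_ofPred_eq, Set.mem_univ, iff_true]
    exact (stopT_le ⟨by simp, Or.inr le_rfl⟩).trans hqt
  have : Nonempty (Set.Icc p t) := ⟨⟨p, le_rfl, hpt⟩⟩
  have key : {ω : Omega | stopT p r l c ω ≤ t} =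
      ⋂ n : ℕ, ⋃ k : ℕ, {ω : Omega |
        l * (ω.1 (TopologicalSpace.denseSeq (Set.Icc p t) k).1 - ω.1 p) < -c + 1 / ((n : ℝ) + 1)} := by
    ext ω
    have hg := gain_cont p l ω
    simp only [Set.mem_ofPred_eq, Set.mem_iInter, Set.mem_iUnion, stopT_le_iff]
    constructor
    · rintro ⟨s, hst, hps, hs⟩ n
      have hs' : l * (ω.1 s - ω.1 p) ≤ -c := by
        rcases hs with h | h
        · exact h
        · exact absurd (h.trans hst) hqt
      have hpos : (0 : ℝ) < 1 / ((n : ℝ) + 1) := Nat.one_div_pos_of_nat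
      have hopen : IsOpen {x : Set.Icc p t |
          l * (ω.1 x.1 - ω.1 p) < -c + 1 / ((n : ℝ) + 1)} :=
        isOpen_lt (hg.comp continuous_subtype_val) continuous_const
      obtain ⟨k, hk⟩ := (TopologicalSpace.denseRange_denseSeq (Set.Icc p t)).exists_mem_open hopen
        ⟨⟨s, hps, hst⟩, by simp only [Set.mem_ofPred_eq]; linarith⟩
      exact ⟨k, hk⟩
    · intro h
      obtain ⟨m, hm, hmin⟩ := isCompact_Icc.exists_isMinOn (Set.nonempty_Icc.2 hpt)
        (hg.continuousOn (s := Set.Icc p t))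
      refine ⟨m, hm.2, hm.1, Or.inl ?_⟩
      by_contra! hlt
      obtain ⟨n, hn⟩ := exists_nat_one_div_lt (show 0 < l * (ω.1 m - ω.1 p) + c by linarith)
      obtain ⟨k, hk⟩ := h n
      have := hmin (TopologicalSpace.denseSeq (Set.Icc p t) k).2
      simp only [Set.mem_ofPred_eq] at this
      linarith
  rw [key]
  refine MeasurableSet.iInter fun n => MeasurableSet.iUnion fun k => ?_
  have h1 := meas_eval (TopologicalSpace.denseSeq (Set.Icc p t) k).2.2
  have h2 := meas_eval hpt
  exact measurableSet_lt ((h1.sub h2).const_mul l) measurable_const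

lemma const_stopping (x : ℝ≥0∞) : IsStopping (fun _ => x) := fun _ => MeasurableSet.const _

lemma const_measAt {τ : Omega → ℝ≥0∞} (h : IsStopping τ) (x : ℝ) :
    MeasurableAtTime τ (fun _ => x) := fun B _ t =>
  (MeasurableSet.const (x ∈ B)).inter (h t)

/-- The betting times. -/
noncomputable def betTau (p r : ℝ≥0) (l c : ℝ) : ℕ → Omega → ℝ≥0∞
  | 0 => fun _ => (p : ℝ≥0∞)
  | 1 => fun ω => (stopT p r l c ω : ℝ≥0∞)
  | _ + 2 => fun _ => ⊤

/-- The stakes. -/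
noncomputable def betH (l : ℝ) : ℕ → Omega → ℝ
  | 0 => fun _ => l
  | _ + 1 => fun _ => 0

lemma betTau_stopping (p r : ℝ≥0) (l c : ℝ) : ∀ n, IsStopping (betTau p r l c n)
  | 0 => const_stopping _
  | 1 => stopT_stopping p r l c
  | _ + 2 => const_stopping _

/-- The elementary strategy: hold `l` units from time `p` until the stopping time. -/
noncomputable def bet (p r : ℝ≥0) (l c : ℝ) : ElemStrategy where
  τ := betTau p r l c
  stopping := betTau_stopping p r l c
  mono := by
    intro n ω
    match n with
    | 0 => exact ENNReal.coe_le_coe.2 (stopT_mem p r l c ω).1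
    | 1 => exact le_top
    | _ + 2 => exact le_top
  tendsto_top := by
    intro ω
    refine tendsto_const_nhds.congr' ?_
    filter_upwards [eventually_ge_atTop 2] with n hn
    obtain ⟨m, rfl⟩ := Nat.exists_eq_add_of_le' hn
    rfl
  h := betH l
  h_bdd := by
    intro n
    match n with
    | 0 => exact ⟨|l|, fun _ => le_rfl⟩
    | _ + 1 => exact ⟨0, fun _ => by simp [betH]⟩
  h_meas := by
    intro n
    match n with
    | 0 => exact const_measAt (betTau_stopping p r l c 0) l
    | k + 1 => exact const_measAt (betTau_stopping p r l c (k + 1)) 0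

lemma bet_capital (p r : ℝ≥0) (l c c' : ℝ) (t : ℝ≥0) (ω : Omega) :
    elemCapital (bet p r l c) c' t ω =
      c' + l * (ω.1 (min (stopT p r l c ω) t) - ω.1 (min p t)) := by
  unfold elemCapital
  rw [tsum_eq_single 0]
  · simp only [bet, betH, clip, betTau, ← ENNReal.coe_min, ENNReal.toNNReal_coe]
  · intro n hn
    obtain ⟨m, rfl⟩ := Nat.exists_eq_succ_of_ne_zero hn
    simp [bet, betH]

lemma bet_nonneg (p r : ℝ≥0) (l : ℝ) {c : ℝ} (hc : 0 < c) (t : ℝ≥0) (ω : Omega) :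
    0 ≤ elemCapital (bet p r l c) c t ω := by
  rw [bet_capital]
  have hpT := (stopT_mem p r l c ω).1
  rcases le_total t p with h | h
  · rw [min_eq_right h, min_eq_right (h.trans hpT)]
    simp [hc.le]
  · rw [min_eq_left h]
    have := gain_ge hc (le_min hpT h) (min_le_left (stopT p r l c ω) t)
    linarith

lemma bet_win {p r : ℝ≥0} {l c : ℝ} (hc : 0 < c) {ω : Omega}
    (h0 : ∀ s, p ≤ s → s ≤ p + r → 0 ≤ l * (ω.1 s - ω.1 p))
    (h1 : 1 ≤ l * (ω.1 (p + r) - ω.1 p)) {t : ℝ≥0} (ht : p + r ≤ t) :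
    1 ≤ elemCapital (bet p r l c) c t ω := by
  rw [bet_capital]
  have hT : stopT p r l c ω = p + r := by
    refine le_antisymm (stopT_le ⟨by simp, Or.inr le_rfl⟩) ?_
    obtain ⟨h2, h3⟩ := stopT_mem p r l c ω
    rcases h3 with h3 | h3
    · by_contra! hlt
      have := h0 _ h2 hlt.le
      linarith
    · exact h3
  have hpt : p ≤ t := le_trans (by simp) ht
  rw [hT, min_eq_left ht, min_eq_left hpt]
  linarith

/-- The winning event for one bet. -/
def Wins (f : ℝ≥0 → ℝ) (p r : ℝ≥0) (l : ℝ) : Prop :=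
  (∀ s, p ≤ s → s ≤ p + r → 0 ≤ l * (f s - f p)) ∧ 1 ≤ l * (f (p + r) - f p)

lemma null_of_wins (E : Set Omega)
    (hE : ∀ ω ∈ E, ∃ (p r : ℚ≥0) (l : ℚ), Wins ω.1 (p : ℝ≥0) (r : ℝ≥0) (l : ℝ)) :
    IsNull E := by
  obtain ⟨e, he⟩ := exists_surjective_nat (ℚ≥0 × ℚ≥0 × ℚ)
  refine le_antisymm (ENNReal.le_of_forall_pos_le_add fun ε hε _ => ?_) bot_le
  have hεr : (0 : ℝ) < ε := hε
  have hcpos : ∀ n : ℕ, (0 : ℝ) < (ε : ℝ) / 2 / 2 ^ n := fun n => by positivity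
  let S : PosCapital :=
    { G := fun n => bet ((e n).1 : ℝ≥0) ((e n).2.1 : ℝ≥0) ((e n).2.2 : ℝ) ((ε : ℝ) / 2 / 2 ^ n)
      c := fun n => (ε : ℝ) / 2 / 2 ^ n
      c_pos := hcpos
      c_summable := summable_geometric_two' _
      nonneg := fun n t ω => bet_nonneg _ _ _ (hcpos n) t ω }
  have hinit : S.init = (ε : ℝ≥0∞) := by
    change ∑' n : ℕ, ENNReal.ofReal ((ε : ℝ) / 2 / 2 ^ n) = _
    rw [← ENNReal.ofReal_tsum_of_nonneg (fun n => (hcpos n).le) (summable_geometric_two' _),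
      tsum_geometric_two', ENNReal.ofReal_coe_nnreal]
  rw [zero_add, ← hinit]
  refine iInf₂_le S fun ω => ?_
  by_cases hω : ω ∈ E
  · rw [Set.indicator_of_mem hω]
    obtain ⟨p, r, l, h0, h1⟩ := hE ω hω
    obtain ⟨n, hn⟩ := he (p, r, l)
    refine le_liminf_of_le (by isBoundedDefault) ?_
    filter_upwards [eventually_ge_atTop ((p : ℝ≥0) + (r : ℝ≥0))] with t ht
    have hw := bet_win (hcpos n) h0 h1 ht
    calc (1 : ℝ≥0∞) = ENNReal.ofReal 1 := by simp
      _ ≤ ENNReal.ofReal (elemCapital (S.G n) (S.c n) t ω) := by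
        apply ENNReal.ofReal_le_ofReal
        change 1 ≤ elemCapital (bet ((e n).1 : ℝ≥0) ((e n).2.1 : ℝ≥0) ((e n).2.2 : ℝ)
          ((ε : ℝ) / 2 / 2 ^ n)) _ t ω
        rw [hn]
        exact hw
      _ ≤ S.value t ω := ENNReal.le_tsum n
  · rw [Set.indicator_of_notMem hω]
    exact bot_le

lemma quasi {ω : Omega} {a b c : ℝ≥0} (hab : a < b) (hbc : b < c)
    (hno : ∀ s, a ≤ s → s ≤ c → ¬ PointOfLocalMax ω s) :
    ω.1 b ≤ max (ω.1 a) (ω.1 c) := by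
  by_contra! hlt
  obtain ⟨hla, hlc⟩ := max_lt_iff.1 hlt
  have hac : a ≤ c := (hab.trans hbc).le
  obtain ⟨m, hm, hmax⟩ := isCompact_Icc.exists_isMaxOn (Set.nonempty_Icc.2 hac)
    (ω.2.continuousOn (s := Set.Icc a c))
  have hcomp : IsCompact (Set.Icc a c ∩ {s | ω.1 m ≤ ω.1 s}) :=
    isCompact_Icc.inter_right (isClosed_le continuous_const ω.2)
  obtain ⟨k, ⟨hk, hmk⟩, hleast⟩ := hcomp.exists_isLeast ⟨m, hm, le_refl (ω.1 m)⟩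
  simp only [Set.mem_ofPred_eq] at hmk
  have hmax' : ∀ s ∈ Set.Icc a c, ω.1 s ≤ ω.1 m := fun s hs => hmax hs
  have hbm := hmax' b ⟨hab.le, hbc.le⟩
  have hak : a < k := lt_of_le_of_ne hk.1 (by rintro rfl; linarith)
  have hkc : k < c := lt_of_le_of_ne hk.2 (by rintro rfl; linarith)
  have hak' : (a : ℝ) < k := hak
  have hkc' : (k : ℝ) < c := hkc
  refine hno k hk.1 hk.2 ⟨?_, min ((k : ℝ) - a) ((c : ℝ) - k), lt_min (by linarith) (by linarith),
    fun s h1 h2 => ?_⟩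
  · rintro ⟨δ, hδ, hconst⟩
    obtain ⟨x, hx1, hx2⟩ := exists_between (max_lt hak' (show (k : ℝ) - δ < k by linarith))
    obtain ⟨hx3, hx4⟩ := max_lt_iff.1 hx1
    have hx0 : 0 ≤ x := a.2.trans hx3.le
    lift x to ℝ≥0 using hx0
    have h := hconst x hx4 (by linarith)
    have hxk : x < k := hx2
    have hax : a < x := hx3
    exact absurd (hleast ⟨⟨hax.le, hxk.le.trans hk.2⟩, by
      simp only [Set.mem_ofPred_eq]; linarith⟩) (not_le.2 hxk)
  · have h3 := min_le_left ((k : ℝ) - a) ((c : ℝ) - k)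
    have h4 := min_le_right ((k : ℝ) - a) ((c : ℝ) - k)
    have h5 : (a : ℝ) ≤ s := by linarith
    have h6 : (s : ℝ) ≤ c := by linarith
    exact (hmax' s ⟨h5, h6⟩).trans hmk

lemma exists_nnrat_mem {U : Set ℝ≥0} (hU : IsOpen U) (hne : U.Nonempty) :
    ∃ p : ℚ≥0, (p : ℝ≥0) ∈ U := by
  obtain ⟨x, hx⟩ := hne
  obtain ⟨d, hd, hsub⟩ := Metric.isOpen_iff.1 hU x hx
  obtain ⟨q, hq1, hq2⟩ := exists_rat_btwn (show (x : ℝ) < x + d by linarith)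
  have hq0 : (0 : ℝ) ≤ q := x.2.trans hq1.le
  have hq0' : 0 ≤ q := by exact_mod_cast hq0
  lift q to ℚ≥0 using hq0'
  refine ⟨q, hsub ?_⟩
  rw [Metric.mem_ball, NNReal.dist_eq, abs_lt]
  have : (((q : ℝ≥0) : ℝ)) = (((q : ℚ) : ℝ)) := by
    rw [Rat.cast_nnratCast]; rfl
  rw [this]
  constructor <;> linarith

/-- Interpolation: a rational point strictly between, with value strictly between. -/
lemma exists_mid {f : ℝ≥0 → ℝ} (hf : Continuous f) {a b : ℝ≥0} (hab : a < b)
    (h : f a < f b) : ∃ p : ℚ≥0, a < (p : ℝ≥0) ∧ (p : ℝ≥0) < b ∧ f a < f p ∧ f p < f b := by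
  obtain ⟨x, hx, hfx⟩ := intermediate_value_Ioo hab.le hf.continuousOn
    (show (f a + f b) / 2 ∈ Set.Ioo (f a) (f b) from ⟨by linarith, by linarith⟩)
  obtain ⟨p, hp1, hp2⟩ := exists_nnrat_mem
    (U := Set.Ioo a b ∩ f ⁻¹' (Set.Ioo (f a) (f b)))
    (isOpen_Ioo.inter (isOpen_Ioo.preimage hf))
    ⟨x, hx, by rw [Set.mem_preimage, hfx]; exact ⟨by linarith, by linarith⟩⟩
  exact ⟨p, hp1.1, hp1.2, hp2.1, hp2.2⟩

lemma wins_of_sign {f : ℝ≥0 → ℝ} {p q : ℚ≥0} (hpq : (p : ℝ≥0) < q) (h : f p < f q)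
    (hs : ∀ s, (p : ℝ≥0) ≤ s → s ≤ q → f p ≤ f s) :
    ∃ (p r : ℚ≥0) (l : ℚ), Wins f (p : ℝ≥0) (r : ℝ≥0) (l : ℝ) := by
  have hpq' : p ≤ q := by exact_mod_cast hpq.le
  have hsum : (p : ℝ≥0) + ((q - p : ℚ≥0) : ℝ≥0) = q := by
    rw [← NNRat.cast_add, add_tsub_cancel_of_le hpq']
  have hd : 0 < f q - f p := by linarith
  obtain ⟨l, hl⟩ := exists_rat_gt (1 / (f q - f p))
  have hl0 : (0 : ℝ) < l := lt_trans (by positivity) hl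
  refine ⟨p, q - p, l, ?_, ?_⟩
  · intro s h1 h2
    rw [hsum] at h2
    exact mul_nonneg hl0.le (by linarith [hs s h1 h2])
  · rw [hsum]
    rw [div_lt_iff₀ hd] at hl
    exact hl.le

lemma wins_neg {f : ℝ≥0 → ℝ}
    (h : ∃ (p r : ℚ≥0) (l : ℚ), Wins (fun s => - f s) (p : ℝ≥0) (r : ℝ≥0) (l : ℝ)) :
    ∃ (p r : ℚ≥0) (l : ℚ), Wins f (p : ℝ≥0) (r : ℝ≥0) (l : ℝ) := by
  obtain ⟨p, r, l, h0, h1⟩ := h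
  refine ⟨p, r, -l, fun s hs hs' => ?_, ?_⟩
  · have := h0 s hs hs'
    push_cast
    linarith
  · push_cast
    linarith

lemma wins_of_quasi {f : ℝ≥0 → ℝ} (hf : Continuous f) {a b : ℝ≥0} (hab : a < b)
    (hne : f a ≠ f b)
    (hq : ∀ x y z, a ≤ x → x < y → y < z → z ≤ b → f y ≤ max (f x) (f z)) :
    ∃ (p r : ℚ≥0) (l : ℚ), Wins f (p : ℝ≥0) (r : ℝ≥0) (l : ℝ) := by
  rcases lt_or_gt_of_ne hne with h | h
  · obtain ⟨p, hap, hpb, h1, h2⟩ := exists_mid hf hab h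
    obtain ⟨q, hpq, hqb, h3, h4⟩ := exists_mid hf hpb h2
    refine wins_of_sign hpq h3 fun s hs hs' => ?_
    rcases hs.eq_or_lt with rfl | hlt
    · exact le_rfl
    · rcases le_max_iff.1 (hq a p s le_rfl hap hlt (hs'.trans hqb.le)) with h5 | h5
      · linarith
      · exact h5
  · apply wins_neg
    obtain ⟨p, hap, hpb, h1, h2⟩ := exists_mid hf.neg hab (neg_lt_neg h)
    obtain ⟨q, hpq, hqb, h3, h4⟩ := exists_mid hf.neg hpb h2
    refine wins_of_sign hpq h3 fun s hs hs' => ?_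
    rcases hs.eq_or_lt with rfl | hlt
    · exact le_rfl
    · rcases hs'.eq_or_lt with rfl | hlt'
      · exact h3.le
      simp only [Pi.neg_apply] at h3
      rcases le_max_iff.1 (hq p s q hap.le hlt hlt' hqb.le) with h5 | h5 <;> linarith

lemma wins_of_noMax {ω : Omega} {t : ℝ≥0} (ht : ¬ PointOfConstancy ω t) {ε : ℝ} (hε : 0 < ε)
    (hno : ¬ ∃ s : ℝ≥0, |(s : ℝ) - (t : ℝ)| < ε ∧ PointOfLocalMax ω s) :
    ∃ (p r : ℚ≥0) (l : ℚ), Wins ω.1 (p : ℝ≥0) (r : ℝ≥0) (l : ℝ) := by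
  have hex : ∃ s : ℝ≥0, (t : ℝ) - ε < s ∧ (s : ℝ) < t + ε ∧ ω.1 s ≠ ω.1 t := by
    by_contra! hcon
    exact ht ⟨ε, hε, hcon⟩
  obtain ⟨s, hs1, hs2, hs3⟩ := hex
  have main : ∀ a b : ℝ≥0, a < b → (t : ℝ) - ε < a → (b : ℝ) < t + ε → ω.1 a ≠ ω.1 b →
      ∃ (p r : ℚ≥0) (l : ℚ), Wins ω.1 (p : ℝ≥0) (r : ℝ≥0) (l : ℝ) := by
    intro a b hab ha hb hne
    refine wins_of_quasi ω.2 hab hne fun x y z hx hxy hyz hz => quasi hxy hyz fun u hu hu' hmax => ?_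
    refine hno ⟨u, ?_, hmax⟩
    have h1 : (a : ℝ) ≤ u := hx.trans hu
    have h2 : (u : ℝ) ≤ b := hu'.trans hz
    rw [abs_lt]
    constructor <;> linarith
  rcases lt_trichotomy s t with h | h | h
  · exact main s t h hs1 (by linarith) hs3
  · exact absurd (by rw [h]) hs3
  · exact main t s h (by linarith) hs2 hs3.symm

lemma constancy_negO {ω : Omega} {t : ℝ≥0} :
    PointOfConstancy (negO ω) t ↔ PointOfConstancy ω t := by
  simp [PointOfConstancy, negO]

lemma localMax_negO {ω : Omega} {t : ℝ≥0} :
    PointOfLocalMax (negO ω) t ↔ PointOfLocalMin ω t := by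
  simp only [PointOfLocalMax, PointOfLocalMin, constancy_negO]
  simp [negO]

/-- almost surely, every neighbourhood of every point of
non-constancy of `ω` contains a point of local maximum and a point of local
minimum of `ω`. -/
theorem extrema_near_points_of_nonconstancy :
    IsNull {ω : Omega | ∃ t : ℝ≥0, ¬ PointOfConstancy ω t ∧
      ∃ ε : ℝ, 0 < ε ∧
        ¬ ((∃ s : ℝ≥0, |(s : ℝ) - (t : ℝ)| < ε ∧ PointOfLocalMax ω s) ∧
           (∃ s : ℝ≥0, |(s : ℝ) - (t : ℝ)| < ε ∧ PointOfLocalMin ω s))} := by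
  apply null_of_wins
  rintro ω ⟨t, ht, ε, hε, hno⟩
  by_cases hmax : ∃ s : ℝ≥0, |(s : ℝ) - (t : ℝ)| < ε ∧ PointOfLocalMax ω s
  · have hmin : ¬ ∃ s : ℝ≥0, |(s : ℝ) - (t : ℝ)| < ε ∧ PointOfLocalMin ω s :=
      fun h => hno ⟨hmax, h⟩
    apply wins_neg
    have h1 : ¬ PointOfConstancy (negO ω) t := fun h => ht (constancy_negO.1 h)
    exact wins_of_noMax h1 hε fun ⟨s, hs, hs'⟩ => hmin ⟨s, hs, localMax_negO.1 hs'⟩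
  · exact wins_of_noMax ht hε hmax

end GTP
end
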